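/- Let ε ≥ 0, γ ≥ 0, δ ≥ 0, T > 0 and M ≥ 0. Let b : ℝ³×[0,T] → ℝ³ be smooth, ℤ³-periodic in the space variable, with |(∇b)(x,t)| ≤ M for all (x,t) (Frobenius norm). Let σ : ℝ³×[0,T] → M₃(ℝ) be smooth, ℤ³-periodic in the space variable, with σ(x,t) symmetric for all (x,t), satisfying pointwise ∂ₜσ = εΔσ − (b·∇)σ + (∇b)σ + σ(∇b)ᵀ − γσ + δI. If σ(x,0) is positive semi-definite for every x ∈ ℝ³, then σ(x,t) is positive semi-definite for every x ∈ ℝ³ and every t ∈ [0,T]. -/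

import Mathlib

open MeasureTheory

noncomputable section

abbrev V3 := Fin 3 → ℝ

/-- spatial partial derivative ∂ᵢf -/
def pd (i : Fin 3) (f : V3 → ℝ) (x : V3) : ℝ := fderiv ℝ f x (Pi.single i 1)

/-- Laplacian of a scalar function -/
def lap (f : V3 → ℝ) (x : V3) : ℝ := ∑ i, pd i (pd i f) x

/-- ℤ³-periodicity -/
def Periodic3 (f : V3 → ℝ) : Prop :=
  ∀ (x : V3) (k : Fin 3 → ℤ), f (x + fun i => (k i : ℝ)) = f x

/-- mollification Jf = η ∗ f -/
def J3 (η f : V3 → ℝ) (x : V3) : ℝ := ∫ y, η (x - y) * f y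

/-- curl ∇×u -/
def curl3 (u : V3 → V3) (x : V3) : V3 :=
  ![pd 1 (fun y => u y 2) x - pd 2 (fun y => u y 1) x,
    pd 2 (fun y => u y 0) x - pd 0 (fun y => u y 2) x,
    pd 0 (fun y => u y 1) x - pd 1 (fun y => u y 0) x]

/-- (v·∇)u -/
def advect (v u : V3 → V3) (x : V3) : V3 :=
  fun i => ∑ j, v x j * pd j (fun y => u y i) x

/-- the bilinear term Ω(v,u) -/
def Omg (v u : V3 → V3) (x : V3) : V3 :=
  ![∑ j, (pd 1 (fun y => v y j) x * pd j (fun y => u y 2) x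
      - pd 2 (fun y => v y j) x * pd j (fun y => u y 1) x),
    ∑ j, (pd 2 (fun y => v y j) x * pd j (fun y => u y 0) x
      - pd 0 (fun y => v y j) x * pd j (fun y => u y 2) x),
    ∑ j, (pd 0 (fun y => v y j) x * pd j (fun y => u y 1) x
      - pd 1 (fun y => v y j) x * pd j (fun y => u y 0) x)]

theorem ContDiff.pd {f : V3 → ℝ} (hf : ContDiff ℝ (⊤:ℕ∞) f) (k : Fin 3) :
    ContDiff ℝ (⊤:ℕ∞) (pd k f) :=
  (hf.fderiv_right (m := (⊤:ℕ∞)) (by simp)).clm_apply contDiff_const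

theorem pd_quadratic_form (V : Fin 3 → ℝ) {F : Fin 3 → Fin 3 → V3 → ℝ}
    (hF : ∀ i j, ContDiff ℝ (⊤:ℕ∞) (F i j)) (k : Fin 3) :
    pd k (fun y => ∑ i, ∑ j, V i * F i j y * V j)
      = fun x => ∑ i, ∑ j, V i * pd k (F i j) x * V j := by
  funext x
  have hd : ∀ i j, HasFDerivAt (F i j) (fderiv ℝ (F i j) x) x := fun i j =>
    ((hF i j).differentiable (by simp) x).hasFDerivAt
  have h : HasFDerivAt (fun y => ∑ i, ∑ j, V i * F i j y * V j)
      (∑ i, ∑ j, V j • (V i • fderiv ℝ (F i j) x)) x :=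
    HasFDerivAt.fun_sum fun i _ => HasFDerivAt.fun_sum fun j _ =>
      ((hd i j).const_mul (V i)).mul_const (V j)
  simp only [pd, h.fderiv, sum_apply, smul_apply,
    smul_eq_mul]
  exact Finset.sum_congr rfl fun i _ => Finset.sum_congr rfl fun j _ => by ring

theorem lap_quadratic_form (V : Fin 3 → ℝ) {F : Fin 3 → Fin 3 → V3 → ℝ}
    (hF : ∀ i j, ContDiff ℝ (⊤:ℕ∞) (F i j)) (x : V3) :
    lap (fun y => ∑ i, ∑ j, V i * F i j y * V j) x
      = ∑ i, ∑ j, V i * lap (F i j) x * V j := by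
  simp only [lap, pd_quadratic_form V hF, pd_quadratic_form V fun i j => (hF i j).pd _]
  simp only [Fin.sum_univ_three]
  ring

theorem deriv_deriv_nonneg_of_isLocalMin {g : ℝ → ℝ} {a : ℝ} (h : IsLocalMin g a)
    (hc : ContinuousAt g a) : 0 ≤ deriv (deriv g) a := by
  by_contra! hneg
  have hmax := isLocalMax_of_deriv_deriv_neg hneg h.deriv_eq_zero hc
  have hconst : g =ᶠ[nhds a] fun _ => g a := by
    filter_upwards [h, hmax] with y h₁ h₂ using le_antisymm h₂ h₁
  have := hconst.deriv.deriv_eq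
  simp at this
  linarith

theorem hasDerivAt_comp_line {f : V3 → ℝ} (hf : Differentiable ℝ f) (x : V3) (k : Fin 3)
    (s : ℝ) : HasDerivAt (fun s : ℝ => f (x + s • Pi.single k 1))
      (pd k f (x + s • Pi.single k 1)) s := by
  have h : HasDerivAt (fun s : ℝ => x + s • (Pi.single k 1 : V3)) (Pi.single k 1) s := by
    simpa using ((hasDerivAt_id s).smul_const (Pi.single k 1 : V3)).const_add x
  exact (hf _).hasFDerivAt.comp_hasDerivAt s h

theorem pd_eq_zero_of_isMin {f : V3 → ℝ} {x : V3} (h : ∀ y, f x ≤ f y) (k : Fin 3) :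
    pd k f x = 0 := by
  have : IsLocalMin f x := Filter.Eventually.of_forall h
  simp [pd, this.fderiv_eq_zero]

theorem lap_nonneg_of_isMin {f : V3 → ℝ} (hf : ContDiff ℝ (⊤:ℕ∞) f) {x : V3}
    (h : ∀ y, f x ≤ f y) : 0 ≤ lap f x := by
  refine Finset.sum_nonneg fun k _ => ?_
  have h₁ := hasDerivAt_comp_line (hf.differentiable (by simp)) x k
  have h₂ := hasDerivAt_comp_line ((hf.pd k).differentiable (by simp)) x k
  have hmin : IsLocalMin (fun s : ℝ => f (x + s • Pi.single k 1)) 0 :=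
    Filter.Eventually.of_forall fun s => by simpa using h _
  have := deriv_deriv_nonneg_of_isLocalMin hmin (h₁ 0).continuousAt
  rw [funext fun s => (h₁ s).deriv, (h₂ 0).deriv] at this
  simpa using this

theorem isCompact_setOf_sum_sq_eq_one : IsCompact {V : Fin 3 → ℝ | ∑ i, V i ^ 2 = 1} := by
  refine (isCompact_Icc (a := fun _ : Fin 3 => (-1 : ℝ)) (b := fun _ => 1)).of_isClosed_subset
    (isClosed_eq (by fun_prop) continuous_const) fun V hV => ?_
  have h : ∀ i, V i ^ 2 ≤ 1 := fun i =>
    (Finset.single_le_sum (f := fun i => V i ^ 2) (fun i _ => sq_nonneg _)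
      (Finset.mem_univ i)).trans_eq hV
  exact ⟨fun i => (abs_le.1 ((sq_le_one_iff_abs_le_one _).1 (h i))).1,
    fun i => (abs_le.1 ((sq_le_one_iff_abs_le_one _).1 (h i))).2⟩

theorem Periodic3.exists_mem_Icc (x : V3) : ∃ z ∈ Set.Icc (0 : V3) 1,
    ∀ f : V3 → ℝ, Periodic3 f → f x = f z := by
  refine ⟨fun i => Int.fract (x i), ⟨fun i => Int.fract_nonneg _,
    fun i => (Int.fract_lt_one _).le⟩, fun f hf => ?_⟩
  rw [← hf (fun i => Int.fract (x i)) fun i => ⌊x i⌋]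
  congr 1
  funext i
  simp

theorem quadratic_form_le_of_sqrt_le {G : Fin 3 → Fin 3 → ℝ} {M : ℝ}
    (hG : Real.sqrt (∑ i, ∑ j, G i j ^ 2) ≤ M) {V : Fin 3 → ℝ} (hV : ∑ i, V i ^ 2 = 1) :
    ∑ i, ∑ j, V i * G i j * V j ≤ M := by
  refine le_trans (Real.le_sqrt_of_sq_le ?_) hG
  have h := Finset.sum_mul_sq_le_sq_mul_sq (Finset.univ : Finset (Fin 3 × Fin 3))
    (fun p => V p.1 * V p.2) (fun p => G p.1 p.2)
  simp only [Fintype.sum_prod_type, mul_pow, ← Finset.mul_sum, hV, mul_one, one_mul] at h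
  refine le_trans (le_of_eq ?_) h
  congr 1
  exact Finset.sum_congr rfl fun i _ => by
    exact Finset.sum_congr rfl fun j _ => by ring

open Matrix in
theorem dotProduct_mulVec_eq_sum (A : Matrix (Fin 3) (Fin 3) ℝ) (V : Fin 3 → ℝ) :
    V ⬝ᵥ (A *ᵥ V) = ∑ i, ∑ j, V i * A i j * V j := by
  simp only [dotProduct, mulVec, Finset.mul_sum, mul_assoc]

open Matrix in
theorem mulVec_eq_smul_of_isMin {A : Matrix (Fin 3) (Fin 3) ℝ} (hA : A.IsSymm) {V : Fin 3 → ℝ}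
    (hV : ∑ i, V i ^ 2 = 1)
    (hmin : ∀ W : Fin 3 → ℝ, ∑ i, W i ^ 2 = 1 → V ⬝ᵥ (A *ᵥ V) ≤ W ⬝ᵥ (A *ᵥ W)) :
    A *ᵥ V = (V ⬝ᵥ (A *ᵥ V)) • V := by
  set μ := V ⬝ᵥ (A *ᵥ V) with hμ
  have hdot : ∀ W : Fin 3 → ℝ, W ⬝ᵥ W = ∑ i, W i ^ 2 := fun W => by simp [dotProduct, sq]
  have hform : ∀ W : Fin 3 → ℝ,
      W ⬝ᵥ ((A - μ • (1 : Matrix (Fin 3) (Fin 3) ℝ)) *ᵥ W)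
        = W ⬝ᵥ (A *ᵥ W) - μ * ∑ i, W i ^ 2 := fun W => by
    rw [sub_mulVec, dotProduct_sub, smul_mulVec, one_mulVec, dotProduct_smul, hdot, smul_eq_mul]
  have hpsd : (A - μ • (1 : Matrix (Fin 3) (Fin 3) ℝ)).PosSemidef := by
    refine .of_dotProduct_mulVec_nonneg ?_ fun W => ?_
    · ext i j
      simp [hA.apply, Matrix.one_apply, eq_comm]
    · rw [star_trivial, hform, sub_nonneg]
      rcases (Finset.sum_nonneg fun i _ => sq_nonneg (W i) :
        0 ≤ ∑ i, W i ^ 2).eq_or_lt' with h0 | hpos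
      · have : W = 0 := dotProduct_self_eq_zero.1 ((hdot W).trans h0)
        simp [this]
      · set r := Real.sqrt (∑ i, W i ^ 2)
        have hr : 0 < r := Real.sqrt_pos.2 hpos
        have hrr : r ^ 2 = ∑ i, W i ^ 2 := Real.sq_sqrt hpos.le
        have := hmin (r⁻¹ • W) (by
          simp only [Pi.smul_apply, smul_eq_mul, mul_pow, ← Finset.mul_sum, ← hrr]
          field_simp)
        rw [mulVec_smul, dotProduct_smul, smul_dotProduct, smul_eq_mul, smul_eq_mul] at this
        rw [← hrr]
        calc μ * r ^ 2 ≤ (r⁻¹ * (r⁻¹ * W ⬝ᵥ (A *ᵥ W))) * r ^ 2 := by gcongr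
          _ = W ⬝ᵥ (A *ᵥ W) := by field_simp
  have h0 := (hpsd.dotProduct_mulVec_zero_iff V).1 (by rw [star_trivial, hform, hV]; simp [μ])
  rwa [sub_mulVec, smul_mulVec, one_mulVec, sub_eq_zero] at h0

theorem HasDerivWithinAt.nonpos_of_isMinOn_Icc {g : ℝ → ℝ} {g' T t : ℝ} (ht : t ∈ Set.Ioc 0 T)
    (hg : HasDerivWithinAt g g' (Set.Icc 0 T) t) (hmin : IsMinOn g (Set.Icc 0 T) t) :
    g' ≤ 0 := by
  have hseg : segment ℝ t 0 ⊆ Set.Icc 0 T :=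
    (convex_Icc 0 T).segment_subset ⟨ht.1.le, ht.2⟩ ⟨le_rfl, ht.1.le.trans ht.2⟩
  have := hmin.localize.hasFDerivWithinAt_nonneg hg.hasFDerivWithinAt
    (sub_mem_posTangentConeAt_of_segment_subset hseg)
  simp at this
  nlinarith [ht.1]

open Matrix in
/-- positive semi-definiteness is preserved by the constitutive
equation ∂ₜσ = εΔσ − (b·∇)σ + (∇b)σ + σ(∇b)ᵀ − γσ + δI with bounded ∇b. -/
theorem posSemidef_preserved (ε γ δ T M : ℝ)
    (hε : 0 ≤ ε) (hγ : 0 ≤ γ) (hδ : 0 ≤ δ) (hT : 0 < T) (hM : 0 ≤ M)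
    (b : V3 → ℝ → V3) (σ : V3 → ℝ → Matrix (Fin 3) (Fin 3) ℝ)
    (hb : ∀ i, ContDiff ℝ (⊤:ℕ∞) (fun q : V3 × ℝ => b q.1 q.2 i))
    (hbper : ∀ t i, Periodic3 (fun x => b x t i))
    (hbM : ∀ (x : V3) (t : ℝ),
      Real.sqrt (∑ i, ∑ j, (pd j (fun y => b y t i) x)^2) ≤ M)
    (hσ : ∀ i j, ContDiff ℝ (⊤:ℕ∞) (fun q : V3 × ℝ => σ q.1 q.2 i j))
    (hσper : ∀ t i j, Periodic3 (fun x => σ x t i j))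
    (hσsymm : ∀ (x : V3) (t : ℝ), (σ x t).IsSymm)
    (hpde : ∀ x : V3, ∀ t ∈ Set.Icc (0:ℝ) T, ∀ i j,
      HasDerivWithinAt (fun s => σ x s i j)
        (ε * lap (fun y => σ y t i j) x
          - (∑ k, b x t k * pd k (fun y => σ y t i j) x)
          + (∑ k, pd k (fun y => b y t i) x * σ x t k j)
          + (∑ k, σ x t i k * pd k (fun y => b y t j) x)
          - γ * σ x t i j
          + δ * (if i = j then (1:ℝ) else 0))
        (Set.Icc (0:ℝ) T) t)
    (hinit : ∀ (x : V3) (V : Fin 3 → ℝ), 0 ≤ V ⬝ᵥ ((σ x 0) *ᵥ V)) :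
    ∀ x : V3, ∀ t ∈ Set.Icc (0:ℝ) T, ∀ V : Fin 3 → ℝ, 0 ≤ V ⬝ᵥ ((σ x t) *ᵥ V) := by
  set q : V3 → ℝ → (Fin 3 → ℝ) → ℝ := fun x t V => ∑ i, ∑ j, V i * σ x t i j * V j with hq
  have hqform : ∀ x t V, V ⬝ᵥ (σ x t *ᵥ V) = q x t V := fun x t V =>
    dotProduct_mulVec_eq_sum _ _
  set S : Set (Fin 3 → ℝ) := {V | ∑ i, V i ^ 2 = 1} with hS
  set lam : ℝ := 2 * M + 1 with hlam
  have hcont : Continuous fun p : V3 × ℝ × (Fin 3 → ℝ) =>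
      Real.exp (-lam * p.2.1) * q p.1 p.2.1 p.2.2 := by
    have : ∀ i j, Continuous fun p : V3 × ℝ × (Fin 3 → ℝ) => σ p.1 p.2.1 i j := fun i j =>
      (hσ i j).continuous.comp (continuous_fst.prodMk (continuous_fst.comp continuous_snd))
    fun_prop
  obtain ⟨⟨x₀, t₀, V₀⟩, ⟨-, ht₀, hV₀⟩, hmin⟩ :=
    ((isCompact_Icc (a := (0 : V3)) (b := 1)).prod
      ((isCompact_Icc (a := (0 : ℝ)) (b := T)).prod
        isCompact_setOf_sum_sq_eq_one)).exists_isMinOn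
      ⟨(0, 0, Pi.single 0 1), ⟨le_rfl, zero_le_one⟩, ⟨le_rfl, hT.le⟩, by
        simp [Fin.sum_univ_three]⟩ hcont.continuousOn
  replace ht₀ : t₀ ∈ Set.Icc 0 T := ht₀
  replace hV₀ : V₀ ∈ S := hV₀
  have hglob : ∀ x, ∀ t ∈ Set.Icc (0 : ℝ) T, ∀ V ∈ S,
      Real.exp (-lam * t₀) * q x₀ t₀ V₀ ≤ Real.exp (-lam * t) * q x t V := by
    intro x t ht V hV
    obtain ⟨z, hz, hfz⟩ := Periodic3.exists_mem_Icc x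
    have : q x t V = q z t V := by
      simp only [hq]
      exact Finset.sum_congr rfl fun i _ => Finset.sum_congr rfl fun j _ => by
        rw [hfz _ (hσper t i j)]
    rw [this]
    exact hmin (a := (z, t, V)) ⟨hz, ht, hV⟩
  have hm : 0 ≤ q x₀ t₀ V₀ := by
    by_contra! hneg
    set μ := q x₀ t₀ V₀ with hμ
    have hfix : ∀ x, ∀ V ∈ S, μ ≤ q x t₀ V := fun x V hV =>
      le_of_mul_le_mul_left (hglob x t₀ ht₀ V hV) (Real.exp_pos _)
    have ht₀pos : 0 < t₀ := by
      refine ht₀.1.lt_of_ne fun h => hneg.not_ge ?_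
      rw [hμ, ← h, ← hqform]
      exact hinit _ _
    have heig : ∀ k, ∑ j, σ x₀ t₀ k j * V₀ j = μ * V₀ k := fun k => by
      have := mulVec_eq_smul_of_isMin (hσsymm x₀ t₀) hV₀ fun W hW => by
        rw [hqform, hqform]; exact hfix x₀ W hW
      rw [hqform] at this
      exact congrFun this k
    have hsm : ∀ i j, ContDiff ℝ (⊤:ℕ∞) fun y => σ y t₀ i j := fun i j =>
      (hσ i j).comp (contDiff_id.prodMk contDiff_const)
    have hsmq : ContDiff ℝ (⊤:ℕ∞) fun y => q y t₀ V₀ :=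
      ContDiff.sum fun i _ => ContDiff.sum fun j _ =>
        (contDiff_const.mul (hsm i j)).mul contDiff_const
    have hgrad : ∀ k, ∑ i, ∑ j, V₀ i * pd k (fun y => σ y t₀ i j) x₀ * V₀ j = 0 := fun k => by
      rw [← pd_eq_zero_of_isMin (f := fun y => q y t₀ V₀) (x := x₀) (fun y => hfix y V₀ hV₀) k]
      exact (congrFun (pd_quadratic_form V₀ hsm k) x₀).symm
    have hlap : 0 ≤ ∑ i, ∑ j, V₀ i * lap (fun y => σ y t₀ i j) x₀ * V₀ j := by
      rw [← lap_quadratic_form V₀ hsm x₀]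
      exact lap_nonneg_of_isMin hsmq fun y => hfix y V₀ hV₀
    have hG := quadratic_form_le_of_sqrt_le (hbM x₀ t₀) hV₀
    have hder := HasDerivWithinAt.fun_sum (u := Finset.univ) fun i _ =>
      HasDerivWithinAt.fun_sum (u := Finset.univ) fun j _ =>
        ((hpde x₀ t₀ ht₀ i j).const_mul (V₀ i)).mul_const (V₀ j)
    have hexp : HasDerivWithinAt (fun s => Real.exp (-lam * s))
        (Real.exp (-lam * t₀) * (-lam * 1)) (Set.Icc 0 T) t₀ :=
      (((hasDerivAt_id t₀).const_mul (-lam)).exp).hasDerivWithinAt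
    have hle := (hexp.mul hder).nonpos_of_isMinOn_Icc ⟨ht₀pos, ht₀.2⟩
      fun s hs => hglob x₀ s hs V₀ hV₀
    set D := ∑ i, ∑ j, V₀ i * (ε * lap (fun y => σ y t₀ i j) x₀
          - (∑ k, b x₀ t₀ k * pd k (fun y => σ y t₀ i j) x₀)
          + (∑ k, pd k (fun y => b y t₀ i) x₀ * σ x₀ t₀ k j)
          + (∑ k, σ x₀ t₀ i k * pd k (fun y => b y t₀ j) x₀)
          - γ * σ x₀ t₀ i j
          + δ * (if i = j then (1:ℝ) else 0)) * V₀ j with hD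
    have hle' : -lam * μ + D ≤ 0 := by
      refine nonpos_of_mul_nonpos_right (a := Real.exp (-lam * t₀)) ?_ (Real.exp_pos _)
      refine le_trans (le_of_eq ?_) hle
      simp only [hμ, hq]
      ring
    have hDeq : D = ε * (∑ i, ∑ j, V₀ i * lap (fun y => σ y t₀ i j) x₀ * V₀ j)
        - ∑ k, b x₀ t₀ k * (∑ i, ∑ j, V₀ i * pd k (fun y => σ y t₀ i j) x₀ * V₀ j)
        + ∑ i, ∑ k, V₀ i * pd k (fun y => b y t₀ i) x₀ * (∑ j, σ x₀ t₀ k j * V₀ j)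
        + ∑ j, ∑ k, V₀ j * pd k (fun y => b y t₀ j) x₀ * (∑ i, σ x₀ t₀ k i * V₀ i)
        - γ * μ + δ * ∑ i, V₀ i ^ 2 := by
      have hs : ∀ i k, σ x₀ t₀ i k = σ x₀ t₀ k i := fun i k => (hσsymm x₀ t₀).apply k i
      have h₁ := hs 1 0
      have h₂ := hs 2 0
      have h₃ := hs 2 1
      simp only [hD, hμ, hq, Fin.sum_univ_three, h₁, h₂, h₃]
      simp
      ring
    have hμG : ∑ i, ∑ k, V₀ i * pd k (fun y => b y t₀ i) x₀ * (μ * V₀ k)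
        = μ * ∑ i, ∑ k, V₀ i * pd k (fun y => b y t₀ i) x₀ * V₀ k := by
      simp only [Finset.mul_sum]
      exact Finset.sum_congr rfl fun i _ => Finset.sum_congr rfl fun k _ => by ring
    have hV₀' : ∑ i, V₀ i ^ 2 = 1 := hV₀
    simp only [heig, hgrad, hμG, hV₀', mul_zero, Finset.sum_const_zero] at hDeq
    nlinarith [mul_nonneg hε hlap, mul_nonneg hγ (neg_nonneg.2 hneg.le),
      mul_nonneg (sub_nonneg.2 hG) (neg_nonneg.2 hneg.le)]
  intro x t ht V
  rw [hqform]
  rcases (Finset.sum_nonneg fun i _ => sq_nonneg (V i) :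
    0 ≤ ∑ i, V i ^ 2).eq_or_lt' with h0 | hpos
  · have hV : V = 0 := dotProduct_self_eq_zero.1 (by simpa [dotProduct, sq] using h0)
    simp [hq, hV]
  · set r := Real.sqrt (∑ i, V i ^ 2)
    have hr : 0 < r := Real.sqrt_pos.2 hpos
    have hrr : r ^ 2 = ∑ i, V i ^ 2 := Real.sq_sqrt hpos.le
    have hmem : r⁻¹ • V ∈ S := by
      simp only [hS, Set.mem_ofPred_eq, Pi.smul_apply, smul_eq_mul, mul_pow, ← Finset.mul_sum,
        ← hrr]
      field_simp
    have hnn : 0 ≤ q x t (r⁻¹ • V) :=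
      nonneg_of_mul_nonneg_right
        ((mul_nonneg (Real.exp_pos _).le hm).trans (hglob x t ht _ hmem)) (Real.exp_pos _)
    rw [← hqform, mulVec_smul, dotProduct_smul, smul_dotProduct, smul_eq_mul, smul_eq_mul,
      hqform] at hnn
    have hr' := inv_pos.2 hr
    exact nonneg_of_mul_nonneg_right (nonneg_of_mul_nonneg_right hnn hr') hr'
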